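/- Let S₀ be a finite set of odd primes and Γ′_S the subgroup of Λ_S generated by the classes of the elements of A′_p for p ∈ S₀. Then: (1) every element of Γ′_S is the class of a quaternion with integer coordinates (a, b, c, d) satisfying either (a odd and b, c, d even) or (a, c, d odd and b even); (2) Γ′_S is torsion-free: every element of Γ′_S of finite order is the identity. -/

import Mathlib

open Quaternion

noncomputable section

/-- The ring `ℤ_S = ℤ[1/(2·∏_{p∈S₀} p)]`, realized as the subring of `ℚ` generated by
`1/2` and `1/p` for `p ∈ S₀`. -/
def ZS (S₀ : Finset ℕ) : Subring ℚ :=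
  Subring.closure ({(2 : ℚ)⁻¹} ∪ {x : ℚ | ∃ p ∈ S₀, x = (p : ℚ)⁻¹})

/-- The central subgroup of scalar units of an `R`-algebra. -/
def scalarUnits (R A : Type*) [CommRing R] [Ring A] [Algebra R A] : Subgroup Aˣ :=
  (Units.map (algebraMap R A).toMonoidHom).range

instance scalarUnits_normal (R A : Type*) [CommRing R] [Ring A] [Algebra R A] :
    (scalarUnits R A).Normal := by
  constructor
  intro n hn g
  obtain ⟨r, rfl⟩ := hn
  refine ⟨r, Units.ext ?_⟩
  simp only [Units.val_mul, Units.coe_map, RingHom.toMonoidHom_eq_coe, MonoidHom.coe_coe]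
  rw [← Algebra.commutes (r : R) ((g : Aˣ) : A), mul_assoc, Units.mul_inv, mul_one]

/-- The group `Λ_S = ℍ[ℤ_S]ˣ/ℤ_Sˣ`. -/
abbrev LambdaH (S₀ : Finset ℕ) : Type :=
  ℍ[(ZS S₀)]ˣ ⧸ scalarUnits (ZS S₀) ℍ[(ZS S₀)]

/-- The class `[w]` of a unit `w`. -/
abbrev clsH (S₀ : Finset ℕ) : ℍ[(ZS S₀)]ˣ →* LambdaH S₀ :=
  QuotientGroup.mk' _

/-- The set `A'_p` of integer quaternions `a + bi + cj + dk` of reduced norm `p` with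
`a` odd, `b, c, d` even if `p ≡ 1 (mod 4)`, and `a, c, d` odd, `b` even if
`p ≡ 3 (mod 4)`. -/
def Ap' (S₀ : Finset ℕ) (p : ℕ) : Set ℍ[(ZS S₀)] :=
  {x | ∃ a b c d : ℤ,
    x = (⟨(a : ZS S₀), (b : ZS S₀), (c : ZS S₀), (d : ZS S₀)⟩ : ℍ[(ZS S₀)]) ∧
    a ^ 2 + b ^ 2 + c ^ 2 + d ^ 2 = (p : ℤ) ∧
    ((p % 4 = 1 ∧ Odd a ∧ Even b ∧ Even c ∧ Even d) ∨
     (p % 4 = 3 ∧ Odd a ∧ Even b ∧ Odd c ∧ Odd d))}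

/-- The group `Γ'_S ⊆ Λ_S`, generated by the classes of the elements of `A'_p`, `p ∈ S₀`. -/
def GammaH' (S₀ : Finset ℕ) : Subgroup (LambdaH S₀) :=
  Subgroup.closure {z | ∃ p ∈ S₀, ∃ w : ℍ[(ZS S₀)]ˣ,
    (w : ℍ[(ZS S₀)]) ∈ Ap' S₀ p ∧ z = clsH S₀ w}

/-- The quaternion over `R` with the given integer coordinates. -/
def Quaternion.ofInts (R : Type*) [CommRing R] (a b c d : ℤ) : ℍ[R] := ⟨a, b, c, d⟩

namespace Quaternion

variable {R : Type*} [CommRing R] (a b c d : ℤ)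

@[simp] theorem re_ofInts : (ofInts R a b c d).re = a := rfl

@[simp] theorem imI_ofInts : (ofInts R a b c d).imI = b := rfl

@[simp] theorem imJ_ofInts : (ofInts R a b c d).imJ = c := rfl

@[simp] theorem imK_ofInts : (ofInts R a b c d).imK = d := rfl

theorem ofInts_pow (n : ℕ) :
    ofInts R a b c d ^ n =
      let q := (⟨a, 1⟩ : ℤ√(-(b ^ 2 + c ^ 2 + d ^ 2))) ^ n
      ofInts R q.re (q.im * b) (q.im * c) (q.im * d) := by
  induction n with
  | zero => ext <;> simp
  | succ n ih =>
    rw [pow_succ, ih]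
    ext <;> simp [pow_succ] <;> ring

end Quaternion

/-- A quaternion over `ℤ_S` has integer coordinates and is congruent to `1` or `1 + j + k`
modulo `2`. -/
def HasOddTypeCoords {S₀ : Finset ℕ} (x : ℍ[(ZS S₀)]) : Prop :=
  ∃ a b c d : ℤ,
    x = Quaternion.ofInts (ZS S₀) a b c d ∧
    ((Odd a ∧ Even b ∧ Even c ∧ Even d) ∨ (Odd a ∧ Even b ∧ Odd c ∧ Odd d))

namespace HasOddTypeCoords

variable {S₀ : Finset ℕ} {x y : ℍ[(ZS S₀)]}

theorem one : HasOddTypeCoords (1 : ℍ[(ZS S₀)]) :=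
  ⟨1, 0, 0, 0, by ext <;> simp, by simp⟩

theorem mul (hx : HasOddTypeCoords x) (hy : HasOddTypeCoords y) :
    HasOddTypeCoords (x * y) := by
  obtain ⟨a, b, c, d, rfl, h⟩ := hx
  obtain ⟨a', b', c', d', rfl, h'⟩ := hy
  refine ⟨a * a' - b * b' - c * c' - d * d', a * b' + b * a' + c * d' - d * c',
    a * c' - b * d' + c * a' + d * b', a * d' + b * c' - c * b' + d * a', ?_, ?_⟩
  · ext <;> simp
  · simp only [← Int.not_even_iff_odd, Int.even_add, Int.even_sub, Int.even_mul] at h h' ⊢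
    rcases h with ⟨ha, hb, hc, hd⟩ | ⟨ha, hb, hc, hd⟩ <;>
      rcases h' with ⟨ha', hb', hc', hd'⟩ | ⟨ha', hb', hc', hd'⟩ <;>
      simp [ha, hb, hc, hd, ha', hb', hc', hd']

theorem star (hx : HasOddTypeCoords x) : HasOddTypeCoords (star x) := by
  obtain ⟨a, b, c, d, rfl, h⟩ := hx
  refine ⟨a, -b, -c, -d, ?_, ?_⟩
  · ext <;> simp
  · simpa only [even_neg, odd_neg] using h

end HasOddTypeCoords

theorem clsH_star (S₀ : Finset ℕ) (w : ℍ[(ZS S₀)]ˣ) : clsH S₀ (star w) = (clsH S₀ w)⁻¹ := by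
  rw [← map_inv]
  symm
  refine (QuotientGroup.eq).2 ?_
  rw [inv_inv]
  refine ⟨Units.map (Quaternion.normSq (R := ZS S₀)).toMonoidHom w, Units.ext ?_⟩
  exact (Quaternion.self_mul_star (w : ℍ[(ZS S₀)])).symm

theorem exists_hasOddTypeCoords_of_mem_GammaH' {S₀ : Finset ℕ} {z : LambdaH S₀}
    (hz : z ∈ GammaH' S₀) :
    ∃ w : ℍ[(ZS S₀)]ˣ, z = clsH S₀ w ∧ HasOddTypeCoords (w : ℍ[(ZS S₀)]) := by
  induction hz using Subgroup.closure_induction with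
  | mem z hz =>
    obtain ⟨p, -, w, ⟨a, b, c, d, hw, -, h⟩, rfl⟩ := hz
    exact ⟨w, rfl, a, b, c, d, hw, h.imp And.right And.right⟩
  | one => exact ⟨1, (map_one _).symm, HasOddTypeCoords.one⟩
  | mul z z' _ _ hz hz' =>
    obtain ⟨w, rfl, hw⟩ := hz
    obtain ⟨w', rfl, hw'⟩ := hz'
    exact ⟨w * w', (map_mul _ _ _).symm, hw.mul hw'⟩
  | inv z _ hz =>
    obtain ⟨w, rfl, hw⟩ := hz
    exact ⟨star w, (clsH_star S₀ w).symm, hw.star⟩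

theorem Zsqrtd.odd_re_pow_and_odd_im_pow_iff {m a : ℤ} (hm : Even m) (ha : Odd a) (n : ℕ) :
    Odd ((⟨a, 1⟩ : ℤ√m) ^ n).re ∧ (Odd ((⟨a, 1⟩ : ℤ√m) ^ n).im ↔ Odd n) := by
  induction n with
  | zero => simp
  | succ n ih =>
    obtain ⟨h₁, h₂⟩ := ih
    rw [← Int.not_even_iff_odd, ← Nat.not_even_iff_odd] at h₂
    rw [← Int.not_even_iff_odd] at h₁ ha
    rw [pow_succ, ← Int.not_even_iff_odd, ← Int.not_even_iff_odd, ← Nat.not_even_iff_odd]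
    simp only [Zsqrtd.re_mul, Zsqrtd.im_mul, Int.even_add, Int.even_mul, Nat.even_add_one, mul_one]
    tauto

/-- A quadratic integer `a + √m` with `a` odd and `m` even has no positive power in `ℤ`. -/
theorem Zsqrtd.im_pow_ne_zero {m a : ℤ} (hm : Even m) (ha : Odd a) {n : ℕ} (hn : n ≠ 0) :
    ((⟨a, 1⟩ : ℤ√m) ^ n).im ≠ 0 := by
  induction n using Nat.strong_induction_on with
  | _ n ih =>
    rcases Nat.even_or_odd n with ⟨k, rfl⟩ | h
    · have hk : k ≠ 0 := by omega
      have him := ih k (by omega) hk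
      have hre : ((⟨a, 1⟩ : ℤ√m) ^ k).re ≠ 0 := fun h0 => by
        simpa [h0] using (odd_re_pow_and_odd_im_pow_iff hm ha k).1
      rw [pow_add, Zsqrtd.im_mul, mul_comm _ (Zsqrtd.re _), ← two_mul]
      exact mul_ne_zero two_ne_zero (mul_ne_zero hre him)
    · intro h0
      simpa [h0] using (odd_re_pow_and_odd_im_pow_iff hm ha n).2.2 h

theorem mem_scalarUnits_of_pow_mem {S₀ : Finset ℕ} {w : ℍ[(ZS S₀)]ˣ}
    (hw : HasOddTypeCoords (w : ℍ[(ZS S₀)])) {n : ℕ} (hn : n ≠ 0)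
    (h : w ^ n ∈ scalarUnits (ZS S₀) ℍ[(ZS S₀)]) : w ∈ scalarUnits (ZS S₀) ℍ[(ZS S₀)] := by
  obtain ⟨a, b, c, d, hw, hpar⟩ := hw
  have ha : Odd a := hpar.elim And.left And.left
  have hm : Even (-(b ^ 2 + c ^ 2 + d ^ 2)) := by
    simp only [← Int.not_even_iff_odd, even_neg, Int.even_add, Int.even_pow] at hpar ⊢
    tauto
  have him := Zsqrtd.im_pow_ne_zero hm ha hn
  obtain ⟨r, hr⟩ := h
  have hr' : ((r : ZS S₀) : ℍ[(ZS S₀)]) = (w : ℍ[(ZS S₀)]) ^ n := congrArg Units.val hr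
  rw [hw, Quaternion.ofInts_pow] at hr'
  have hb := congrArg QuaternionAlgebra.imI hr'
  have hc := congrArg QuaternionAlgebra.imJ hr'
  have hd := congrArg QuaternionAlgebra.imK hr'
  simp only [Quaternion.imI_coe, Quaternion.imJ_coe, Quaternion.imK_coe,
    Quaternion.imI_ofInts, Quaternion.imJ_ofInts, Quaternion.imK_ofInts] at hb hc hd
  have hb0 : b = 0 := (mul_eq_zero.1 (Int.cast_eq_zero.1 hb.symm)).resolve_left him
  have hc0 : c = 0 := (mul_eq_zero.1 (Int.cast_eq_zero.1 hc.symm)).resolve_left him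
  have hd0 : d = 0 := (mul_eq_zero.1 (Int.cast_eq_zero.1 hd.symm)).resolve_left him
  subst hb0 hc0 hd0
  have hinv : (a : ZS S₀) * (↑w⁻¹ : ℍ[(ZS S₀)]).re = 1 := by
    have := congrArg QuaternionAlgebra.re w.mul_inv
    rw [hw] at this
    simpa using this
  refine ⟨⟨a, _, hinv, (mul_comm _ _).trans hinv⟩, Units.ext ?_⟩
  rw [hw]
  change ((a : ZS S₀) : ℍ[(ZS S₀)]) = _
  ext <;> simp

/-- Every element of `Γ'_S` is the class of an integer quaternion with
`(a odd, b, c, d even)` or `(a, c, d odd, b even)`, and `Γ'_S` is torsion-free. -/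
theorem gammaH'_integral_representatives_and_torsionFree
    (S₀ : Finset ℕ) (hS₀ : ∀ p ∈ S₀, p.Prime ∧ Odd p) :
    -- (1) integral representatives with the stated parities
    (∀ z ∈ GammaH' S₀, ∃ w : ℍ[(ZS S₀)]ˣ, z = clsH S₀ w ∧
      ∃ a b c d : ℤ,
        (w : ℍ[(ZS S₀)]) =
          (⟨(a : ZS S₀), (b : ZS S₀), (c : ZS S₀), (d : ZS S₀)⟩ : ℍ[(ZS S₀)]) ∧
        ((Odd a ∧ Even b ∧ Even c ∧ Even d) ∨
         (Odd a ∧ Even b ∧ Odd c ∧ Odd d))) ∧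
    -- (2) torsion-freeness
    (∀ g : GammaH' S₀, IsOfFinOrder g → g = 1) := by
  refine ⟨fun z hz => exists_hasOddTypeCoords_of_mem_GammaH' hz, fun g hg => ?_⟩
  obtain ⟨n, hn, hgn⟩ := isOfFinOrder_iff_pow_eq_one.1 hg
  obtain ⟨w, hgw, hw⟩ := exists_hasOddTypeCoords_of_mem_GammaH' g.2
  have hpow : clsH S₀ (w ^ n) = 1 := by
    rw [map_pow, ← hgw, ← Subgroup.coe_pow, hgn, Subgroup.coe_one]
  refine Subtype.ext (hgw.trans ?_)
  exact (QuotientGroup.eq_one_iff w).2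
    (mem_scalarUnits_of_pow_mem hw hn.ne' ((QuotientGroup.eq_one_iff (w ^ n)).1 hpow))
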